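/- Let f be a minmax monotone cost function on a finite tree T_in, 𝒯 ≥ 0, and T = (V,E) a rooted working subtree with sink set S and hub tree T_{H(S)}. If T is RC-viable with respect to S, then at least one of the following holds: (i) there exists an edge (u,v) ∈ E_{H(S)} with v the parent of u that satisfies the reaching criterion; or (ii) T is recursively self-sufficient, and in particular V can be partitioned into blocks {P_s : s ∈ S}, each a subtree with s ∈ P_s and f(P_s, s) ≤ 𝒯. -/

import Mathlib

open SimpleGraph Set
open scoped ENNReal

variable {V : Type*}

/-- The vertex set of the connected component of the subgraph of `G` induced on `A`
containing the vertex `u` (empty if `u ∉ A`). -/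
def reachSet (G : SimpleGraph V) (A : Set V) (u : V) : Set V :=
  {y | ∃ (hu : u ∈ A) (hy : y ∈ A), (G.induce A).Reachable ⟨u, hu⟩ ⟨y, hy⟩}

/-- `U` is a subtree: the induced subgraph on `U` is connected. -/
def IsSubtree (G : SimpleGraph V) (U : Set V) : Prop :=
  (G.induce U).Connected

/-- A minmax monotone cost function on the tree `G`:
`f {s} s = 0`; `f U s = ∞` if `U` is not a subtree or `s ∉ U`; set monotonicity;
path monotonicity; and max tree composition (the slices of `U` defined by `s` being the
connected components of `U \ {s}`). -/
structure IsMinmaxMonotone (G : SimpleGraph V) (f : Set V → V → ℝ≥0∞) : Prop where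
  singleton_eq_zero : ∀ s : V, f {s} s = 0
  eq_top_of_not_subtree : ∀ (U : Set V) (s : V), ¬ IsSubtree G U → f U s = ⊤
  eq_top_of_not_mem : ∀ (U : Set V) (s : V), s ∉ U → f U s = ⊤
  set_mono : ∀ (U₁ U₂ : Set V) (s : V), IsSubtree G U₁ → IsSubtree G U₂ →
    s ∈ U₁ → U₁ ⊆ U₂ → f U₁ s ≤ f U₂ s
  path_mono : ∀ (U : Set V) (s u : V), IsSubtree G U → s ∉ U → u ∈ U → G.Adj s u →
    f U u ≤ f (U ∪ {s}) s
  max_comp : ∀ (U : Set V) (s : V), IsSubtree G U → s ∈ U →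
    f U s = ⨆ x ∈ U \ {s}, f (reachSet G (U \ {s}) x ∪ {s}) s

/-- `s` is a leaf of the (working) tree induced on `W`. -/
def IsLeafOf (G : SimpleGraph V) (W : Set V) (s : V) : Prop :=
  s ∈ W ∧ ∃! u, u ∈ W ∧ G.Adj s u

/-- The ordered pair `(u,v)` satisfies the peaking criterion in the working tree on `W`
with sink set `S` and threshold `𝒯`. -/
def PeakingPair (G : SimpleGraph V) (f : Set V → V → ℝ≥0∞) (𝒯 : ℝ≥0∞)
    (W S : Set V) (u v : V) : Prop :=
  u ∈ W ∧ v ∈ W ∧ G.Adj u v ∧ S ∩ reachSet G (W \ {v}) u = ∅ ∧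
    f (reachSet G (W \ {v}) u) u ≤ 𝒯 ∧ 𝒯 < f (reachSet G (W \ {v}) u ∪ {v}) v

/-- `w` lies on the unique path from `a` to `b` in the tree induced on `W`. -/
def OnPath (G : SimpleGraph V) (W : Set V) (a b w : V) : Prop :=
  a ∈ W ∧ b ∈ W ∧ w ∈ W ∧ b ∉ reachSet G (W \ {w}) a

/-- Vertices of the hub tree: union of the paths from the sinks to the root `r`. -/
def hubVerts (G : SimpleGraph V) (W S : Set V) (r : V) : Set V :=
  {w | ∃ s ∈ S, OnPath G W s r w}

/-- `r` is a valid root: a non-sink vertex of the working tree such that at least two of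
the subtrees hanging off it contain sinks. -/
def GoodRoot (G : SimpleGraph V) (W S : Set V) (r : V) : Prop :=
  r ∈ W ∧ r ∉ S ∧
    ∃ η₁ η₂ : V, η₁ ≠ η₂ ∧ η₁ ∈ W ∧ η₂ ∈ W ∧ G.Adj r η₁ ∧ G.Adj r η₂ ∧
      (S ∩ reachSet G (W \ {r}) η₁).Nonempty ∧ (S ∩ reachSet G (W \ {r}) η₂).Nonempty

/-- The working tree on `W` is RC-viable w.r.t. sinks `S` and root `r`: every outstanding
branch, together with the hub-tree node it is attached to, has cost at most `𝒯`. -/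
def RCViable (G : SimpleGraph V) (f : Set V → V → ℝ≥0∞) (𝒯 : ℝ≥0∞)
    (W S : Set V) (r : V) : Prop :=
  ∀ w ∈ hubVerts G W S r, ∀ η ∈ W, G.Adj w η → η ∉ hubVerts G W S r →
    f (reachSet G (W \ {w}) η ∪ {w}) w ≤ 𝒯

/-- The set `A` is self-sufficient: it can be partitioned into subtree blocks, one for
each sink in `S ∩ A`, each block containing its sink and having cost at most `𝒯`. -/
def SelfSufficient (G : SimpleGraph V) (f : Set V → V → ℝ≥0∞) (𝒯 : ℝ≥0∞)
    (S A : Set V) : Prop :=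
  ∃ P : V → Set V,
    (⋃ s ∈ S ∩ A, P s) = A ∧
    (∀ s ∈ S ∩ A, IsSubtree G (P s) ∧ s ∈ P s ∧ f (P s) s ≤ 𝒯) ∧
    (S ∩ A).Pairwise fun s t => Disjoint (P s) (P t)

/-- The vertices of the path `Π(a,b)` in the tree induced on `W`. -/
def pathSet (G : SimpleGraph V) (W : Set V) (a b : V) : Set V :=
  {w | OnPath G W a b w}

/-- All vertices of outstanding branches attached to `w` (given hub-tree vertices `Hub`). -/
def branchesAt (G : SimpleGraph V) (W Hub : Set V) (w : V) : Set V :=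
  ⋃ η ∈ {η : V | η ∈ W ∧ G.Adj w η ∧ η ∉ Hub}, reachSet G (W \ {w}) η

/-- The bulk path `BP(a,b)`: the path `Π(a,b)` together with all outstanding branches
attached to its vertices. -/
def bulkPath (G : SimpleGraph V) (W S : Set V) (r a b : V) : Set V :=
  pathSet G W a b ∪ ⋃ w ∈ pathSet G W a b, branchesAt G W (hubVerts G W S r) w

/-- `v` is the parent of `u` in the hub tree rooted at `r`. -/
def HubParent (G : SimpleGraph V) (W S : Set V) (r u v : V) : Prop :=
  u ∈ hubVerts G W S r ∧ v ∈ hubVerts G W S r ∧ G.Adj u v ∧ OnPath G W u r v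

/-- The ordered pair `(u,v)` satisfies the reaching criterion: `v` is the hub-tree parent
of `u`, `T₋ᵥ(u)` is self-sufficient, and `BP(v,v) ∪ V₋ᵥ(u)` is not self-sufficient. -/
def ReachingPair (G : SimpleGraph V) (f : Set V → V → ℝ≥0∞) (𝒯 : ℝ≥0∞)
    (W S : Set V) (r u v : V) : Prop :=
  HubParent G W S r u v ∧
  SelfSufficient G f 𝒯 S (reachSet G (W \ {v}) u) ∧
  ¬ SelfSufficient G f 𝒯 S (bulkPath G W S r v v ∪ reachSet G (W \ {v}) u)

/-- The vertex set `V(v)` of the subtree of the working tree (rooted at `r`) rooted at `v`: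
all vertices whose path to the root passes through `v`. -/
def rootedBelow (G : SimpleGraph V) (W : Set V) (r v : V) : Set V :=
  {x | OnPath G W x r v}

/-- The rooted subtree `T(v)` is RC-viable: every outstanding branch attached to a
hub-tree node lying in `T(v)` has, together with its attachment node, cost at most `𝒯`. -/
def RCViableBelow (G : SimpleGraph V) (f : Set V → V → ℝ≥0∞) (𝒯 : ℝ≥0∞)
    (W S : Set V) (r v : V) : Prop :=
  ∀ w ∈ hubVerts G W S r ∩ rootedBelow G W r v, ∀ η ∈ W, G.Adj w η →
    η ∉ hubVerts G W S r → f (reachSet G (W \ {w}) η ∪ {w}) w ≤ 𝒯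

/-- The subtree with vertex set `A` (of the working tree rooted at `r`) is recursively
self-sufficient: for every hub-tree node `w` in `A`, the part of `A` lying below `w`
is self-sufficient. -/
def RecursivelySelfSufficientOn (G : SimpleGraph V) (f : Set V → V → ℝ≥0∞) (𝒯 : ℝ≥0∞)
    (W S : Set V) (r : V) (A : Set V) : Prop :=
  ∀ w ∈ hubVerts G W S r ∩ A, SelfSufficient G f 𝒯 S (rootedBelow G W r w ∩ A)

/-- A feasible sink configuration: a partition of all of `V_in` into subtree blocks,
one per sink, each block containing exactly its own sink and having cost at most `𝒯`. -/
def IsFeasibleConfig (G : SimpleGraph V) (f : Set V → V → ℝ≥0∞) (𝒯 : ℝ≥0∞)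
    (St : Set V) (P : V → Set V) : Prop :=
  (⋃ s ∈ St, P s) = Set.univ ∧
  St.Pairwise (fun s t => Disjoint (P s) (P t)) ∧
  ∀ s ∈ St, IsSubtree G (P s) ∧ St ∩ P s = {s} ∧ f (P s) s ≤ 𝒯

/-- An optimal feasible sink configuration: one with the minimum number of sinks. -/
def IsOptimalConfig (G : SimpleGraph V) (f : Set V → V → ℝ≥0∞) (𝒯 : ℝ≥0∞)
    (St : Set V) (P : V → Set V) : Prop :=
  IsFeasibleConfig G f 𝒯 St P ∧
  ∀ (St' : Set V) (P' : V → Set V), IsFeasibleConfig G f 𝒯 St' P' → St.ncard ≤ St'.ncard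

/-- A partial sink configuration relative to the working tree on `W`: pairwise disjoint
subtree blocks of cost at most `𝒯`, one per sink of `Sout`, covering `V_in \ (W \ Sout)`. -/
def IsPartialConfig (G : SimpleGraph V) (f : Set V → V → ℝ≥0∞) (𝒯 : ℝ≥0∞)
    (W : Set V) (Sout : Set V) (P : V → Set V) : Prop :=
  Sout.Pairwise (fun s t => Disjoint (P s) (P t)) ∧
  (∀ s ∈ Sout, IsSubtree G (P s) ∧ s ∈ P s ∧ f (P s) s ≤ 𝒯) ∧
  (⋃ s ∈ Sout, P s) = Set.univ \ (W \ Sout)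

/-- `(St, Pt)` is an optimal feasible sink configuration witnessing the optimality of the
partial configuration `(Sout, P)` relative to the working tree on `W` (conditions (C1)-(C3)). -/
def WitnessesOptimality (G : SimpleGraph V) (f : Set V → V → ℝ≥0∞) (𝒯 : ℝ≥0∞)
    (W : Set V) (Sout : Set V) (P : V → Set V) (St : Set V) (Pt : V → Set V) : Prop :=
  IsOptimalConfig G f 𝒯 St Pt ∧
  Sout ⊆ St ∧
  St \ W = Sout \ W ∧
  (∀ s ∈ Sout ∩ W, IsLeafOf G W s) ∧
  (∀ s ∈ St, s ∉ W → Pt s = P s ∧ Pt s ∩ W = ∅) ∧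
  (∀ s ∈ Sout ∩ W, P s ⊆ Pt s ∧ Pt s \ P s ⊆ W) ∧
  (∀ s ∈ St, s ∉ Sout → Pt s ⊆ W)

/-- The partial sink configuration `(Sout, P)` is optimal relative to the working tree on `W`. -/
def OptimalRelative (G : SimpleGraph V) (f : Set V → V → ℝ≥0∞) (𝒯 : ℝ≥0∞)
    (W : Set V) (Sout : Set V) (P : V → Set V) : Prop :=
  ∃ (St : Set V) (Pt : V → Set V), WitnessesOptimality G f 𝒯 W Sout P St Pt

section reachSet

variable {G : SimpleGraph V} {A B W S : Set V} {a b c r s u v w x y z : V}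

theorem mem_reachSet_iff :
    y ∈ reachSet G A x ↔ ∃ p : G.Walk x y, ∀ z ∈ p.support, z ∈ A := by
  constructor
  · rintro ⟨hx, hy, ⟨p⟩⟩
    refine ⟨p.map (Embedding.induce A).toHom, fun z hz ↦ ?_⟩
    obtain ⟨z', -, rfl⟩ := List.mem_map.1
      ((congrArg (z ∈ ·) (p.support_map (Embedding.induce A).toHom)).mp hz)
    exact z'.2
  · rintro ⟨p, hp⟩
    exact ⟨hp _ p.start_mem_support, hp _ p.end_mem_support, ⟨p.induce A hp⟩⟩

theorem reachSet_subset : reachSet G A x ⊆ A := fun _ h ↦ h.2.1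

theorem mem_reachSet_self (hx : x ∈ A) : x ∈ reachSet G A x := ⟨hx, hx, .rfl⟩

theorem mem_reachSet_symm (h : y ∈ reachSet G A x) : x ∈ reachSet G A y :=
  let ⟨hx, hy, h⟩ := h; ⟨hy, hx, h.symm⟩

theorem mem_reachSet_trans (hxy : y ∈ reachSet G A x) (hyz : z ∈ reachSet G A y) :
    z ∈ reachSet G A x :=
  let ⟨hx, _, h⟩ := hxy; let ⟨_, hz, h'⟩ := hyz; ⟨hx, hz, h.trans h'⟩

theorem IsSubtree.mem_reachSet (hW : IsSubtree G W) (hx : x ∈ W) (hy : y ∈ W) :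
    y ∈ reachSet G W x :=
  ⟨hx, hy, hW.preconnected _ _⟩

theorem exists_isPath_of_mem_reachSet (h : y ∈ reachSet G A x) :
    ∃ p : G.Walk x y, p.IsPath ∧ ∀ z ∈ p.support, z ∈ A := by
  classical
  obtain ⟨p, hp⟩ := mem_reachSet_iff.1 h
  exact ⟨p.bypass, p.bypass_isPath, fun z hz ↦ hp z (p.support_bypass_subset_support hz)⟩

/-- In a connected set, each vertex other than `w` is reached through a neighbor of `w`. -/
theorem IsSubtree.exists_adj_mem_reachSet (hW : IsSubtree G W) (hw : w ∈ W) (hx : x ∈ W)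
    (hne : x ≠ w) : ∃ η ∈ W, G.Adj w η ∧ x ∈ reachSet G (W \ {w}) η := by
  obtain ⟨p, hp, hpW⟩ := exists_isPath_of_mem_reachSet (hW.mem_reachSet hw hx)
  cases p with
  | nil => exact absurd rfl hne
  | @cons _ η _ h q =>
    rw [Walk.cons_isPath_iff] at hp
    simp only [Walk.support_cons, List.mem_cons, forall_eq_or_imp] at hpW
    refine ⟨η, hpW.2 _ q.start_mem_support, h, mem_reachSet_iff.2 ⟨q, fun z hz ↦ ?_⟩⟩
    exact ⟨hpW.2 z hz, fun hzw ↦ hp.2 (hzw ▸ hz)⟩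

/-- In a connected set, each vertex lies on one of the two sides of an edge. -/
theorem IsSubtree.mem_reachSet_or (hW : IsSubtree G W) (hu : u ∈ W) (hne : u ≠ w)
    (hx : x ∈ W) : x ∈ reachSet G (W \ {w}) u ∨ x ∈ reachSet G (W \ {u}) w := by
  classical
  obtain ⟨p, hp, hpW⟩ := exists_isPath_of_mem_reachSet (hW.mem_reachSet hx hu)
  by_cases hw : w ∈ p.support
  · refine .inr (mem_reachSet_symm (mem_reachSet_iff.2 ⟨p.takeUntil w hw, fun z hz ↦
      ⟨hpW z (p.support_takeUntil_subset_support hw hz), fun hzu ↦ ?_⟩⟩))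
    exact Walk.endpoint_notMem_support_takeUntil hp hw hne (hzu ▸ hz)
  · exact .inl (mem_reachSet_symm (mem_reachSet_iff.2 ⟨p, fun z hz ↦
      ⟨hpW z hz, fun hzw ↦ hw (hzw ▸ hz)⟩⟩))

/-- A connection in `A` either avoids `w` or passes through `w`. -/
theorem mem_reachSet_of_not_mem_diff_singleton (h : y ∈ reachSet G (W \ B) x)
    (hn : y ∉ reachSet G (W \ {w}) x) : w ∈ reachSet G (W \ B) x := by
  classical
  obtain ⟨p, hp⟩ := mem_reachSet_iff.1 h
  have hw : w ∈ p.support := by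
    by_contra hw
    exact hn (mem_reachSet_iff.2 ⟨p, fun z hz ↦ ⟨(hp z hz).1, fun hzw ↦ hw (hzw ▸ hz)⟩⟩)
  exact mem_reachSet_iff.2 ⟨p.takeUntil w hw, fun z hz ↦
    hp z (p.support_takeUntil_subset_support hw hz)⟩

theorem reachable_deleteEdges_of_mem_reachSet (h : y ∈ reachSet G A x)
    (hab : a ∉ A ∨ b ∉ A) : (G.deleteEdges {s(a, b)}).Reachable x y := by
  obtain ⟨p, hp⟩ := mem_reachSet_iff.1 h
  refine reachable_deleteEdges_iff_exists_walk.2 ⟨p, fun he ↦ ?_⟩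
  rcases hab with hab | hab
  · exact hab (hp _ (p.fst_mem_support_of_mem_edges he))
  · exact hab (hp _ (p.snd_mem_support_of_mem_edges he))

theorem SimpleGraph.IsAcyclic.disjoint_reachSet_of_adj (hG : G.IsAcyclic) (hab : G.Adj a b) :
    Disjoint (reachSet G (W \ {b}) a) (reachSet G (W \ {a}) b) := by
  refine Set.disjoint_left.2 fun x hxa hxb ↦ ?_
  refine isBridge_iff.1 (isAcyclic_iff_forall_adj_isBridge.1 hG hab) ?_
  exact (reachable_deleteEdges_of_mem_reachSet hxa (by simp)).trans
    (reachable_deleteEdges_of_mem_reachSet hxb (by simp)).symm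

theorem SimpleGraph.IsAcyclic.disjoint_reachSet_of_ne (hG : G.IsAcyclic) (ha : G.Adj w a)
    (hb : G.Adj w b) (hab : a ≠ b) :
    Disjoint (reachSet G (W \ {w}) a) (reachSet G (W \ {w}) b) := by
  refine Set.disjoint_left.2 fun x hxa hxb ↦ ?_
  refine isBridge_iff.1 (isAcyclic_iff_forall_adj_isBridge.1 hG ha) ?_
  have hwb : (G.deleteEdges {s(w, a)}).Adj w b := by
    rw [deleteEdges_adj]
    refine ⟨hb, fun h ↦ hab ?_⟩
    have := Sym2.congr_right.1 (mem_singleton_iff.1 h)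
    exact this.symm
  exact hwb.reachable.trans ((reachable_deleteEdges_of_mem_reachSet hxb (by simp)).trans
    (reachable_deleteEdges_of_mem_reachSet hxa (by simp)).symm)

end reachSet

section hub

variable {G : SimpleGraph V} {W S : Set V} {r s u v w x η : V}

/-- The first vertex below a hub vertex on a path to a sink below it is a hub vertex. -/
theorem mem_hubVerts_of_mem_reachSet (hG : G.IsAcyclic) (hs : s ∈ S) (hsw : OnPath G W s r w)
    (hη : η ∈ W) (hadj : G.Adj w η) (hsη : s ∈ reachSet G (W \ {w}) η) :
    η ∈ hubVerts G W S r := by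
  obtain ⟨hsW, hrW, -, hn⟩ := hsw
  refine ⟨s, hs, hsW, hrW, hη, fun h ↦ ?_⟩
  have hw := mem_reachSet_of_not_mem_diff_singleton h hn
  exact disjoint_left.1 (hG.disjoint_reachSet_of_adj hadj.symm) hsη
    (mem_reachSet_symm hw)

/-- A neighbor of a hub vertex lying towards the root is a hub vertex. -/
theorem mem_hubVerts_of_root_mem_reachSet (hG : G.IsAcyclic) (hw : w ∈ hubVerts G W S r)
    (hη : η ∈ W) (hadj : G.Adj w η) (hr : r ∈ reachSet G (W \ {w}) η) :
    η ∈ hubVerts G W S r := by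
  obtain ⟨s, hs, hsW, hrW, -, hn⟩ := hw
  refine ⟨s, hs, hsW, hrW, hη, fun h ↦ ?_⟩
  have hw := mem_reachSet_of_not_mem_diff_singleton h hn
  exact disjoint_left.1 (hG.disjoint_reachSet_of_adj hadj.symm) hr
    (mem_reachSet_trans (mem_reachSet_symm hw) h)

theorem rootedBelow_subset : rootedBelow G W r v ⊆ W := fun _ h ↦ h.1

theorem rootedBelow_root (hr : r ∈ W) : rootedBelow G W r r = W :=
  rootedBelow_subset.antisymm fun _ hx ↦ ⟨hx, hr, hr, fun h ↦ (reachSet_subset h).2 rfl⟩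

theorem mem_rootedBelow_self (hr : r ∈ W) (hw : w ∈ W) : w ∈ rootedBelow G W r w :=
  ⟨hw, hr, hw, fun h ↦ h.1.2 rfl⟩

theorem rootedBelow_eq_reachSet (hG : G.IsAcyclic) (hW : IsSubtree G W)
    (h : HubParent G W S r u w) : rootedBelow G W r u = reachSet G (W \ {w}) u := by
  obtain ⟨-, -, hadj, huW, hrW, hwW, hn⟩ := h
  ext x
  constructor
  · rintro ⟨hxW, -, -, hnx⟩
    refine (hW.mem_reachSet_or huW hadj.ne hxW).resolve_right fun hx ↦ hnx ?_
    exact mem_reachSet_trans (mem_reachSet_symm hx)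
      ((hW.mem_reachSet_or huW hadj.ne hrW).resolve_left hn)
  · intro hx
    refine ⟨(reachSet_subset hx).1, hrW, huW, fun hr ↦ ?_⟩
    have hw := mem_reachSet_of_not_mem_diff_singleton hr
      (fun hr' ↦ hn (mem_reachSet_trans hx hr'))
    exact disjoint_left.1 (hG.disjoint_reachSet_of_adj hadj) hx
      (mem_reachSet_symm hw)

theorem mem_bulkPath_self_iff (hw : w ∈ W) :
    x ∈ bulkPath G W S r w w ↔ x = w ∨
      ∃ η ∈ W, G.Adj w η ∧ η ∉ hubVerts G W S r ∧ x ∈ reachSet G (W \ {w}) η := by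
  have hpath : pathSet G W w w = {w} := by
    ext x
    refine ⟨fun ⟨_, _, _, h⟩ ↦ ?_, ?_⟩
    · by_contra hne
      exact h (mem_reachSet_self ⟨hw, fun h' ↦ hne (mem_singleton_iff.2 h'.symm)⟩)
    · rintro rfl
      exact ⟨hw, hw, hw, fun h ↦ h.1.2 rfl⟩
  simp only [bulkPath, hpath, branchesAt, mem_union, mem_singleton_iff, iUnion_iUnion_eq_left,
    mem_iUnion, mem_ofPred_eq, exists_prop, and_assoc]

/-- The part of a working tree below a hub vertex `w` consists of `BP(w, w)` and the parts
below the hub children of `w`. -/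
theorem rootedBelow_eq_bulkPath_union (hG : G.IsAcyclic) (hW : IsSubtree G W)
    (hw : w ∈ hubVerts G W S r) :
    rootedBelow G W r w = bulkPath G W S r w w ∪
      ⋃ u ∈ {u | HubParent G W S r u w}, reachSet G (W \ {w}) u := by
  obtain ⟨s, hs, hsW, hrW, hwW, hn⟩ := id hw
  ext x
  simp only [mem_union, mem_bulkPath_self_iff hwW, mem_iUnion, mem_ofPred_eq, exists_prop]
  constructor
  · rintro ⟨hxW, -, -, hnx⟩
    by_cases hxw : x = w
    · exact .inl (.inl hxw)
    obtain ⟨η, hη, hadj, hx⟩ := hW.exists_adj_mem_reachSet hwW hxW hxw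
    by_cases hηH : η ∈ hubVerts G W S r
    · exact .inr ⟨η, ⟨hηH, hw, hadj.symm, hη, hrW, hwW, fun hr ↦
        hnx (mem_reachSet_trans (mem_reachSet_symm hx) hr)⟩, hx⟩
    · exact .inl (.inr ⟨η, hη, hadj, hηH, hx⟩)
  · rintro ((rfl | ⟨η, hη, hadj, hηH, hx⟩) | ⟨u, hu, hx⟩)
    · exact mem_rootedBelow_self hrW hwW
    · refine ⟨(reachSet_subset hx).1, hrW, hwW, fun hr ↦ hηH ?_⟩
      exact mem_hubVerts_of_root_mem_reachSet hG hw hη hadj (mem_reachSet_trans hx hr)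
    · exact ⟨(reachSet_subset hx).1, hrW, hwW, fun hr ↦
        hu.2.2.2.2.2.2 (mem_reachSet_trans hx hr)⟩

theorem disjoint_bulkPath_reachSet (hG : G.IsAcyclic) (h : HubParent G W S r u w) :
    Disjoint (bulkPath G W S r w w) (reachSet G (W \ {w}) u) := by
  refine Set.disjoint_left.2 fun x hx hxu ↦ ?_
  rcases (mem_bulkPath_self_iff h.2.2.2.2.2.1).1 hx with rfl | ⟨η, _, hadj, hηH, hxη⟩
  · exact (reachSet_subset hxu).2 rfl
  · exact disjoint_left.1 (hG.disjoint_reachSet_of_ne hadj h.2.2.1.symm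
      (fun e ↦ hηH (e ▸ h.1))) hxη hxu

/-- A hub vertex that is not a sink has a child in the hub tree. -/
theorem exists_hubParent (hG : G.IsAcyclic) (hW : IsSubtree G W)
    (hw : w ∈ hubVerts G W S r) (hwS : w ∉ S) : ∃ u, HubParent G W S r u w := by
  obtain ⟨s, hs, hsW, hrW, hwW, hn⟩ := id hw
  obtain ⟨η, hη, hadj, hx⟩ := hW.exists_adj_mem_reachSet hwW hsW (ne_of_mem_of_not_mem hs hwS)
  exact ⟨η, mem_hubVerts_of_mem_reachSet hG hs ⟨hsW, hrW, hwW, hn⟩ hη hadj hx, hw, hadj.symm,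
    hη, hrW, hwW, fun hr ↦ hn (mem_reachSet_trans (mem_reachSet_symm hx) hr)⟩

theorem rootedBelow_of_isLeafOf (hW : IsSubtree G W) (hs : IsLeafOf G W s) (hr : r ∈ W)
    (hne : r ≠ s) : rootedBelow G W r s = {s} := by
  obtain ⟨hsW, t, -, ht⟩ := hs
  ext x
  refine ⟨fun ⟨hxW, _, _, hn⟩ ↦ ?_, fun hx ↦ ?_⟩
  · by_contra hxs
    obtain ⟨a, ha, haadj, hxa⟩ := hW.exists_adj_mem_reachSet hsW hxW hxs
    obtain ⟨b, hb, hbadj, hrb⟩ := hW.exists_adj_mem_reachSet hsW hr hne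
    obtain rfl := ht a ⟨ha, haadj⟩
    obtain rfl := ht b ⟨hb, hbadj⟩
    exact hn (mem_reachSet_trans (mem_reachSet_symm hxa) hrb)
  · rw [mem_singleton_iff.1 hx]
    exact mem_rootedBelow_self hr hsW

end hub

section selfSufficient

variable {G : SimpleGraph V} {f : Set V → V → ℝ≥0∞} {𝒯 : ℝ≥0∞} {W S : Set V} {r s w : V}

theorem SelfSufficient.biUnion {C : Set V} {A : V → Set V}
    (h : ∀ c ∈ C, SelfSufficient G f 𝒯 S (A c)) (hd : C.PairwiseDisjoint A) :
    SelfSufficient G f 𝒯 S (⋃ c ∈ C, A c) := by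
  choose! P hcover hblock hdisj using h
  have hg : ∀ s, ∃ c, s ∈ ⋃ c ∈ C, A c → c ∈ C ∧ s ∈ A c := fun s ↦ by
    by_cases hs : s ∈ ⋃ c ∈ C, A c
    · obtain ⟨c, hc, hsc⟩ := mem_iUnion₂.1 hs
      exact ⟨c, fun _ ↦ ⟨hc, hsc⟩⟩
    · exact ⟨s, fun h ↦ absurd h hs⟩
  choose g hg using hg
  have hgeq : ∀ c ∈ C, ∀ s ∈ A c, g s = c := fun c hc s hs ↦ by
    have := hg s (mem_iUnion₂.2 ⟨c, hc, hs⟩)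
    exact hd.elim_set this.1 hc s this.2 hs
  have hsub : ∀ s ∈ S ∩ ⋃ c ∈ C, A c, P (g s) s ⊆ A (g s) := fun s hs ↦ by
    obtain ⟨hc, hsc⟩ := hg s hs.2
    calc P (g s) s ⊆ ⋃ t ∈ S ∩ A (g s), P (g s) t :=
          subset_biUnion_of_mem (u := fun t ↦ P (g s) t) (show s ∈ S ∩ A (g s) from ⟨hs.1, hsc⟩)
      _ = A (g s) := hcover _ hc
  refine ⟨fun s ↦ P (g s) s, Subset.antisymm ?_ ?_, ?_, ?_⟩
  · exact iUnion₂_subset fun s hs ↦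
      (hsub s hs).trans (subset_biUnion_of_mem (u := A) (hg s hs.2).1)
  · refine iUnion₂_subset fun c hc x hx ↦ ?_
    rw [← hcover c hc] at hx
    obtain ⟨s, hs, hxs⟩ := mem_iUnion₂.1 hx
    refine mem_iUnion₂.2 ⟨s, ⟨hs.1, mem_iUnion₂.2 ⟨c, hc, hs.2⟩⟩, ?_⟩
    simpa only [hgeq c hc s hs.2] using hxs
  · intro s hs
    obtain ⟨hc, hsc⟩ := hg s hs.2
    exact hblock _ hc s ⟨hs.1, hsc⟩
  · intro s hs t ht hst
    obtain ⟨hc, hsc⟩ := hg s hs.2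
    obtain ⟨hc', htc⟩ := hg t ht.2
    by_cases he : g s = g t
    · have := hdisj _ hc ⟨hs.1, hsc⟩ ⟨ht.1, he ▸ htc⟩ hst
      rw [he] at this
      simpa only [he] using this
    · exact (hd hc hc' he).mono (hsub s hs) (hsub t ht)

theorem selfSufficient_singleton (hf : IsMinmaxMonotone G f) (hs : s ∈ S) :
    SelfSufficient G f 𝒯 S {s} := by
  refine ⟨fun _ ↦ {s}, ?_, ?_, ?_⟩
  · rw [inter_eq_self_of_subset_right (singleton_subset_iff.2 hs), biUnion_singleton]
  · rintro t ⟨-, rfl⟩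
    refine ⟨⟨?_⟩, rfl, by simp [hf.singleton_eq_zero]⟩
    exact Preconnected.of_subsingleton
  · rintro t ⟨-, rfl⟩ t' ⟨-, rfl⟩ hne
    exact absurd rfl hne

/-- If no hub edge satisfies the reaching criterion, then the part of the working tree below
each hub vertex is self-sufficient. -/
theorem selfSufficient_rootedBelow [Finite V] (hG : G.IsAcyclic) (hf : IsMinmaxMonotone G f)
    (hW : IsSubtree G W) (hSleaf : ∀ s ∈ S, IsLeafOf G W s) (hrS : r ∉ S)
    (hno : ∀ u v, ¬ ReachingPair G f 𝒯 W S r u v) (w : V) (hw : w ∈ hubVerts G W S r) :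
    SelfSufficient G f 𝒯 S (rootedBelow G W r w) := by
  classical
  induction hn : (rootedBelow G W r w).ncard using Nat.strong_induction_on generalizing w with
  | _ n ih =>
  obtain ⟨s, -, -, hrW, hwW, -⟩ := id hw
  by_cases hwS : w ∈ S
  · rw [rootedBelow_of_isLeafOf hW (hSleaf w hwS) hrW (ne_of_mem_of_not_mem hwS hrS).symm]
    exact selfSufficient_singleton hf hwS
  have hunion := rootedBelow_eq_bulkPath_union hG hW hw
  set C : Set V := {u | HubParent G W S r u w} with hC
  set R : V → Set V := fun u ↦ reachSet G (W \ {w}) u with hR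
  have hself : ∀ u ∈ C, SelfSufficient G f 𝒯 S (R u) := fun u hu ↦ by
    have hbelow : rootedBelow G W r u = R u := rootedBelow_eq_reachSet hG hW hu
    have hlt : (rootedBelow G W r u).ncard < n := by
      rw [← hn]
      refine ncard_lt_ncard (ssubset_iff_exists.2 ⟨?_, w, mem_rootedBelow_self hrW hwW, ?_⟩)
        (toFinite _)
      · rw [hbelow, hunion]
        exact (subset_biUnion_of_mem (u := R) hu).trans subset_union_right
      · rw [hbelow]
        exact fun h ↦ (reachSet_subset h).2 rfl
    exact hbelow ▸ ih _ hlt u hu.1 rfl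
  obtain ⟨u₀, hu₀⟩ := exists_hubParent hG hW hw hwS
  have hbulk : SelfSufficient G f 𝒯 S (bulkPath G W S r w w ∪ R u₀) := by
    by_contra h
    exact hno u₀ w ⟨hu₀, hself u₀ hu₀, h⟩
  set A : V → Set V := fun u ↦ if u = u₀ then bulkPath G W S r w w ∪ R u else R u with hA
  have hAu₀ : A u₀ = bulkPath G W S r w w ∪ R u₀ := if_pos rfl
  have hAne : ∀ u, u ≠ u₀ → A u = R u := fun u hu ↦ if_neg hu
  have hRd : C.PairwiseDisjoint R := fun a ha b hb hab ↦
    hG.disjoint_reachSet_of_ne ha.2.2.1.symm hb.2.2.1.symm hab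
  have hu₀d : ∀ b ∈ C, b ≠ u₀ → Disjoint (A u₀) (A b) := fun b hb hne ↦ by
    rw [hAu₀, hAne b hne, disjoint_union_left]
    exact ⟨disjoint_bulkPath_reachSet hG hb, hRd hu₀ hb hne.symm⟩
  have hAd : C.PairwiseDisjoint A := fun a ha b hb hab ↦ by
    by_cases ha₀ : a = u₀
    · subst ha₀
      exact hu₀d b hb hab.symm
    by_cases hb₀ : b = u₀
    · subst hb₀
      exact (hu₀d a ha hab).symm
    change Disjoint (A a) (A b)
    rw [hAne a ha₀, hAne b hb₀]
    exact hRd ha hb hab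
  have heq : rootedBelow G W r w = ⋃ u ∈ C, A u := by
    rw [hunion]
    refine Subset.antisymm (union_subset ?_ (iUnion₂_mono fun u _ ↦ ?_))
      (iUnion₂_subset fun u hu ↦ ?_)
    · exact (subset_union_left.trans hAu₀.ge).trans (subset_biUnion_of_mem (u := A) hu₀)
    · simp only [hA]
      split_ifs
      exacts [subset_union_right, Subset.rfl]
    · have := subset_biUnion_of_mem (u := R) hu
      simp only [hA]
      split_ifs
      exacts [union_subset_union_right _ this, this.trans subset_union_right]
  rw [heq]
  refine SelfSufficient.biUnion (fun u hu ↦ ?_) hAd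
  by_cases h : u = u₀
  · rw [h, hAu₀]
    exact hbulk
  · rw [hAne u h]
    exact hself u hu

end selfSufficient

/-- Corollary `SSFinal`: if the working tree is RC-viable then either some
hub-tree edge `(u,v)` (with `v` the parent of `u`) satisfies the reaching criterion, or the
whole working tree is recursively self-sufficient — and in particular its vertex set can be
partitioned into subtree blocks `{P_s : s ∈ S}` with `s ∈ P_s` and `f(P_s, s) ≤ 𝒯`. -/
theorem statement_10 [Fintype V] (G : SimpleGraph V) (hG : G.IsTree)
    (f : Set V → V → ℝ≥0∞) (hf : IsMinmaxMonotone G f) (𝒯 : ℝ≥0∞)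
    (W S : Set V) (hW : IsSubtree G W) (hSW : S ⊆ W)
    (hSleaf : ∀ s ∈ S, IsLeafOf G W s)
    (r : V) (hS2 : 2 ≤ S.ncard) (hW2 : 2 < W.ncard) (hroot : GoodRoot G W S r)
    (hRC : RCViable G f 𝒯 W S r) :
    (∃ u v : V, ReachingPair G f 𝒯 W S r u v) ∨
      (RecursivelySelfSufficientOn G f 𝒯 W S r W ∧ SelfSufficient G f 𝒯 S W) := by
  rw [or_iff_not_imp_left]
  intro hno
  push Not at hno
  have hself := selfSufficient_rootedBelow hG.isAcyclic hf hW hSleaf hroot.2.1 hno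
  refine ⟨fun w hw ↦ ?_, ?_⟩
  · rw [inter_eq_self_of_subset_left rootedBelow_subset]
    exact hself w hw.1
  · obtain ⟨s, hs⟩ : S.Nonempty := nonempty_of_ncard_ne_zero (by omega)
    have hr : r ∈ hubVerts G W S r :=
      ⟨s, hs, hSW hs, hroot.1, hroot.1,
        fun h ↦ (reachSet_subset h).2 rfl⟩
    exact rootedBelow_root hroot.1 ▸ hself r hr
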